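/- Let Φ be a recurrent CH system on V with parameter array ({θ_i}_{i=0}^d, {θ*_i}_{i=0}^d, {φ_i}_{i=1}^d) and associated scalars {ϑ_i}_{i=0}^{d+1}. Fix nonzero vectors u* ∈ E*_0V and u ∈ E_0V. Let ξ* denote the (0,d)-entry of the matrix representing A* with respect to the basis {E_i u*}_{i=0}^d, and let ξ denote the (0,d)-entry of the matrix representing A with respect to the basis {E*_i u}_{i=0}^d. Then ξ = (ϑ_1 − ϑ_d)/(θ*_1 − θ*_d) and ξ* = (ϑ_d − ϑ_1)/(θ_1 − θ_d); in particular ξ and ξ* are nonzero. -/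

import Mathlib

open Polynomial Finset Module

variable {F V : Type*} [Field F] [AddCommGroup V] [Module F V]

/-- The primitive idempotent of `A` for the eigenvalue `θ i`, where the eigenvalues of `A`
are `θ 0, …, θ d`. -/
noncomputable def primIdem (d : ℕ) (A : Module.End F V) (θ : ℕ → F) (i : ℕ) :
    Module.End F V :=
  Polynomial.aeval A (∏ j ∈ (Finset.range (d+1)).erase i,
    (Polynomial.C (θ i - θ j)⁻¹ * (Polynomial.X - Polynomial.C (θ j))))

/-- A sequence `σ 0, …, σ n` is `β`-recurrent. -/
def BetaRecurrent (β : F) (n : ℕ) (σ : ℕ → F) : Prop :=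
  ∀ i, 2 ≤ i → i + 1 ≤ n → σ (i-2) - (β+1) * σ (i-1) + (β+1) * σ i - σ (i+1) = 0

/-- The scalars ϑ_i attached to eigenvalue data `θ, θs` and a split sequence `φ`:
`ϑ 0 = 0`, `ϑ (d+1) = 0` and `ϑ i = φ i - (θs i - θs 0)(θ (d-i+1) - θ 0)` for `1 ≤ i ≤ d`. -/
def vth (d : ℕ) (θ θs φ : ℕ → F) (i : ℕ) : F :=
  if 1 ≤ i ∧ i ≤ d then φ i - (θs i - θs 0) * (θ (d - i + 1) - θ 0) else 0

/-- `φ 1, …, φ d` is the split sequence for `(A, As)` with eigenvalue data `θ, θs`: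
there is a (split) basis `v 0, …, v d` of `V` on which `A, As` act in the prescribed way. -/
def SplitSeq (d : ℕ) (A As : Module.End F V) (θ θs φ : ℕ → F) : Prop :=
  ∃ v : ℕ → V,
    LinearIndependent F (fun i : Fin (d+1) => v i) ∧
    Submodule.span F (v '' Set.Iic d) = ⊤ ∧
    (∀ i < d, A (v i) = θ (d - i) • v i + v (i+1)) ∧
    A (v d) = θ 0 • v d ∧
    As (v 0) = θs 0 • v 0 ∧
    (∀ i, 1 ≤ i → i ≤ d → As (v i) = θs i • v i + φ i • v (i-1))

/-- A circular Hessenberg system on `V` of diameter `d`. -/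
structure CHSystem (F V : Type*) [Field F] [AddCommGroup V] [Module F V] (d : ℕ) where
  A : Module.End F V
  As : Module.End F V
  θ : ℕ → F
  θs : ℕ → F
  θ_inj : ∀ i ≤ d, ∀ j ≤ d, θ i = θ j → i = j
  θs_inj : ∀ i ≤ d, ∀ j ≤ d, θs i = θs j → i = j
  A_ann : Polynomial.aeval A (∏ j ∈ Finset.range (d+1), (Polynomial.X - Polynomial.C (θ j))) = 0
  As_ann : Polynomial.aeval As (∏ j ∈ Finset.range (d+1), (Polynomial.X - Polynomial.C (θs j))) = 0
  A_eig : ∀ i ≤ d, Module.End.HasEigenvalue A (θ i)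
  As_eig : ∀ i ≤ d, Module.End.HasEigenvalue As (θs i)
  circ₁ : ∀ i ≤ d, ∀ j ≤ d, ((j:ℤ) + 1 < (i:ℤ) ∨ (1 < (j:ℤ) - (i:ℤ) ∧ (j:ℤ) - (i:ℤ) < (d:ℤ))) →
      primIdem d A θ i * As * primIdem d A θ j = 0
  circ₂ : ∀ i ≤ d, ∀ j ≤ d, ((i:ℤ) = (j:ℤ) + 1 ∨ (j:ℤ) = (i:ℤ) + (d:ℤ)) →
      primIdem d A θ i * As * primIdem d A θ j ≠ 0
  circ₃ : ∀ i ≤ d, ∀ j ≤ d, ((j:ℤ) + 1 < (i:ℤ) ∨ (1 < (j:ℤ) - (i:ℤ) ∧ (j:ℤ) - (i:ℤ) < (d:ℤ))) →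
      primIdem d As θs i * A * primIdem d As θs j = 0
  circ₄ : ∀ i ≤ d, ∀ j ≤ d, ((i:ℤ) = (j:ℤ) + 1 ∨ (j:ℤ) = (i:ℤ) + (d:ℤ)) →
      primIdem d As θs i * A * primIdem d As θs j ≠ 0

section PrimitiveIdempotents

variable {d : ℕ} {T : Module.End F V} {τ : ℕ → F}

theorem aeval_apply_of_apply_eq_smul {μ : F} {w : V} (hw : T w = μ • w) (p : F[X]) :
    aeval T p w = p.eval μ • w := by
  by_cases h0 : w = 0
  · simp [h0]
  · exact Module.End.aeval_apply_of_hasEigenvector ⟨Module.End.mem_eigenspace_iff.2 hw, h0⟩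

theorem primIdem_eq_aeval_basis (d : ℕ) (T : Module.End F V) (τ : ℕ → F) (i : ℕ) :
    primIdem d T τ i = aeval T (Lagrange.basis (range (d + 1)) τ i) := rfl

theorem sum_primIdem (hτ : ∀ i ≤ d, ∀ j ≤ d, τ i = τ j → i = j) :
    ∑ i ∈ range (d + 1), primIdem d T τ i = 1 := by
  have hinj : Set.InjOn τ (range (d + 1) : Finset ℕ) := fun i hi j hj h =>
    hτ i (by simp at hi; omega) j (by simp at hj; omega) h
  have h := congrArg (aeval T) (Lagrange.sum_basis hinj ⟨0, by simp⟩)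
  rw [map_sum, map_one] at h
  exact h

theorem primIdem_apply_comm (i : ℕ) (x : V) :
    primIdem d T τ i (T x) = T (primIdem d T τ i x) := by
  have h : aeval T (Lagrange.basis (range (d + 1)) τ i * X)
      = aeval T (X * Lagrange.basis (range (d + 1)) τ i) := by rw [mul_comm]
  rw [map_mul, map_mul, aeval_X] at h
  exact LinearMap.congr_fun h x

theorem apply_primIdem
    (hann : aeval T (∏ j ∈ range (d + 1), (X - C (τ j))) = 0) {i : ℕ} (hi : i ≤ d) (x : V) :
    T (primIdem d T τ i x) = τ i • primIdem d T τ i x := by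
  have hp : (X - C (τ i)) * Lagrange.basis (range (d + 1)) τ i
      = (∏ j ∈ (range (d + 1)).erase i, C (τ i - τ j)⁻¹) *
        ∏ j ∈ range (d + 1), (X - C (τ j)) := by
    rw [← mul_prod_erase (range (d + 1)) (fun j => X - C (τ j)) (a := i) (by simp; omega)]
    simp only [Lagrange.basis, Lagrange.basisDivisor, prod_mul_distrib]
    ring
  have h := congrArg (aeval T) hp
  rw [map_mul, map_mul, hann, mul_zero, ← primIdem_eq_aeval_basis] at h
  have hx := LinearMap.congr_fun h x
  simpa [sub_eq_zero, Module.algebraMap_end_apply] using hx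

theorem primIdem_apply_map
    (hann : aeval T (∏ j ∈ range (d + 1), (X - C (τ j))) = 0) {i : ℕ} (hi : i ≤ d) (x : V) :
    primIdem d T τ i (T x) = τ i • primIdem d T τ i x := by
  rw [primIdem_apply_comm, apply_primIdem hann hi]

theorem primIdem_apply_self (hτ : ∀ i ≤ d, ∀ j ≤ d, τ i = τ j → i = j) {i : ℕ} (hi : i ≤ d)
    {w : V} (hw : T w = τ i • w) : primIdem d T τ i w = w := by
  have hinj : Set.InjOn τ (range (d + 1) : Finset ℕ) := fun i hi j hj h =>
    hτ i (by simp at hi; omega) j (by simp at hj; omega) h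
  rw [primIdem_eq_aeval_basis, aeval_apply_of_apply_eq_smul hw,
    Lagrange.eval_basis_self hinj (by simp; omega), one_smul]

theorem primIdem_apply_of_ne {i j : ℕ} (hj : j ≤ d) (hij : i ≠ j)
    {w : V} (hw : T w = τ j • w) : primIdem d T τ i w = 0 := by
  rw [primIdem_eq_aeval_basis, aeval_apply_of_apply_eq_smul hw,
    Lagrange.eval_basis_of_ne hij (by simp; omega), zero_smul]

end PrimitiveIdempotents

section UpperBidiagonal

variable {d : ℕ} {T : Module.End F V} {τ φ : ℕ → F} {v : ℕ → V}

theorem primIdem_apply_succ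
    (hann : aeval T (∏ j ∈ range (d + 1), (X - C (τ j))) = 0)
    (hv : ∀ i, 1 ≤ i → i ≤ d → T (v i) = τ i • v i + φ i • v (i - 1))
    {j i : ℕ} (hj : j ≤ d) (hi : i + 1 ≤ d) :
    (τ j - τ (i + 1)) • primIdem d T τ j (v (i + 1)) = φ (i + 1) • primIdem d T τ j (v i) := by
  have h := primIdem_apply_map hann hj (v (i + 1))
  rw [hv (i + 1) (by omega) hi, map_add, map_smul, map_smul, Nat.add_sub_cancel] at h
  rw [sub_smul, ← h, add_sub_cancel_left]

theorem primIdem_zero_apply_mem_span (hτ : ∀ i ≤ d, ∀ j ≤ d, τ i = τ j → i = j)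
    (hann : aeval T (∏ j ∈ range (d + 1), (X - C (τ j))) = 0)
    (hv0 : T (v 0) = τ 0 • v 0)
    (hv : ∀ i, 1 ≤ i → i ≤ d → T (v i) = τ i • v i + φ i • v (i - 1))
    (hspan : Submodule.span F (v '' Set.Iic d) = ⊤) (x : V) :
    primIdem d T τ 0 x ∈ Submodule.span F {v 0} := by
  have hle : Submodule.span F (v '' Set.Iic d)
      ≤ (Submodule.span F {v 0}).comap (primIdem d T τ 0) := by
    rw [Submodule.span_le]
    rintro _ ⟨i, hi, rfl⟩
    simp only [Set.mem_Iic] at hi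
    simp only [SetLike.mem_coe, Submodule.mem_comap]
    induction i with
    | zero =>
      rw [primIdem_apply_self hτ hi hv0]
      exact Submodule.mem_span_singleton_self _
    | succ i ih =>
      have hne : τ 0 - τ (i + 1) ≠ 0 := fun h => by
        have := hτ 0 (by omega) (i + 1) hi (sub_eq_zero.1 h)
        omega
      rw [← Submodule.smul_mem_iff _ hne, primIdem_apply_succ hann hv (by omega) hi]
      exact Submodule.smul_mem _ _ (ih (by omega))
  exact hle (hspan ▸ Submodule.mem_top)

theorem primIdem_zero_apply_ne_zero (hτ : ∀ i ≤ d, ∀ j ≤ d, τ i = τ j → i = j)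
    (hann : aeval T (∏ j ∈ range (d + 1), (X - C (τ j))) = 0)
    (hv0 : T (v 0) = τ 0 • v 0) (hne : v 0 ≠ 0) (hφ : ∀ i, 1 ≤ i → i ≤ d → φ i ≠ 0)
    (hv : ∀ i, 1 ≤ i → i ≤ d → T (v i) = τ i • v i + φ i • v (i - 1))
    {i : ℕ} (hi : i ≤ d) : primIdem d T τ 0 (v i) ≠ 0 := by
  induction i with
  | zero => rwa [primIdem_apply_self hτ hi hv0]
  | succ i ih =>
    intro h
    have hs := primIdem_apply_succ hann hv (Nat.zero_le d) hi
    rw [h, smul_zero] at hs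
    exact smul_ne_zero (hφ (i + 1) (by omega) hi) (ih (by omega)) hs.symm

theorem primIdem_last_apply_eq_zero (hτ : ∀ i ≤ d, ∀ j ≤ d, τ i = τ j → i = j)
    (hann : aeval T (∏ j ∈ range (d + 1), (X - C (τ j))) = 0)
    (hv0 : T (v 0) = τ 0 • v 0)
    (hv : ∀ i, 1 ≤ i → i ≤ d → T (v i) = τ i • v i + φ i • v (i - 1))
    {i : ℕ} (hi : i < d) : primIdem d T τ d (v i) = 0 := by
  induction i with
  | zero => exact primIdem_apply_of_ne (Nat.zero_le d) (by omega) hv0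
  | succ i ih =>
    have hs := primIdem_apply_succ hann hv le_rfl hi.le
    rw [ih (by omega), smul_zero] at hs
    refine (smul_eq_zero.1 hs).resolve_left fun h => ?_
    have := hτ d le_rfl (i + 1) hi.le (sub_eq_zero.1 h)
    omega

end UpperBidiagonal

/-- The corner entry of the matrix representing `A` in the basis `E*_i u`, where `u` spans the
last step of a flag on which `A` is lower bidiagonal and `As` is upper bidiagonal. -/
theorem corner_entry_of_bidiagonal {d : ℕ} (hd : 2 ≤ d) {A As : Module.End F V}
    {θ θs φ ψ : ℕ → F} {v : ℕ → V}
    (hθs : ∀ i ≤ d, ∀ j ≤ d, θs i = θs j → i = j)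
    (hann : aeval As (∏ j ∈ range (d + 1), (X - C (θs j))) = 0)
    (hne : v 0 ≠ 0) (hspan : Submodule.span F (v '' Set.Iic d) = ⊤)
    (hA : ∀ i < d, A (v i) = θ (d - i) • v i + ψ (i + 1) • v (i + 1))
    (hAd : A (v d) = θ 0 • v d)
    (hAs0 : As (v 0) = θs 0 • v 0)
    (hAs : ∀ i, 1 ≤ i → i ≤ d → As (v i) = θs i • v i + φ i • v (i - 1))
    (hφ : ∀ i, 1 ≤ i → i ≤ d → φ i ≠ 0)
    (hzero : ∀ j, 1 < j → j < d → primIdem d As θs 0 * A * primIdem d As θs j = 0)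
    (hcorner : primIdem d As θs 0 * A * primIdem d As θs d ≠ 0)
    {u : V} (hu : u ∈ Submodule.span F {v d}) (hu0 : u ≠ 0) {B : ℕ → ℕ → F}
    (hB : ∀ j ≤ d, A (primIdem d As θs j u)
      = ∑ i ∈ range (d + 1), B i j • primIdem d As θs i u) :
    B 0 d * (θs d - θs 1) = (φ d * ψ d - (θs d - θs 0) * (θ 1 - θ 0))
        - (φ 1 * ψ 1 - (θs 1 - θs 0) * (θ d - θ 0)) ∧ B 0 d ≠ 0 := by
  obtain ⟨c, rfl⟩ := Submodule.mem_span_singleton.1 hu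
  have hc : c ≠ 0 := fun h => hu0 (by rw [h, zero_smul])
  set P := primIdem d As θs with hP
  have hp : P 0 (v d) ≠ 0 := primIdem_zero_apply_ne_zero hθs hann hAs0 hne hφ hAs le_rfl
  -- the top row of `B`, read off by applying `P 0`
  have hrow : ∀ j ≤ d, P 0 (A (P j (v d))) = B 0 j • P 0 (v d) := by
    intro j hj
    have h := congrArg (P 0) (hB j hj)
    rw [map_sum, sum_eq_single_of_mem 0 (by simp)] at h
    · simp only [map_smul] at h
      rw [smul_comm (B 0 j) c] at h
      rw [smul_right_injective V hc h,
        primIdem_apply_self hθs (Nat.zero_le d) (apply_primIdem hann (Nat.zero_le d) _)]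
    · intro i hi hi0
      rw [map_smul, primIdem_apply_of_ne (by simp at hi; omega) hi0.symm
        (apply_primIdem hann (by simp at hi; omega) _), smul_zero]
  have hB0 : ∀ j, 1 < j → j < d → B 0 j = 0 := by
    intro j h1 h2
    have h := LinearMap.congr_fun (hzero j h1 h2) (v d)
    simp only [Module.End.mul_apply, LinearMap.zero_apply] at h
    rw [hrow j h2.le] at h
    exact (smul_eq_zero.1 h).resolve_right hp
  have hsum : ∀ f : ℕ → F, ∑ j ∈ range (d + 1), f j * B 0 j
      = f 0 * B 0 0 + f 1 * B 0 1 + f d * B 0 d := by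
    intro f
    have hsub : ({0, 1, d} : Finset ℕ) ⊆ range (d + 1) := by
      intro i hi
      simp only [mem_insert, mem_singleton] at hi
      simp only [mem_range]
      omega
    rw [← sum_subset hsub]
    · rw [sum_insert (by simp; omega), sum_insert (by simp; omega), sum_singleton, add_assoc]
    · intro i hi hi'
      simp only [mem_insert, mem_singleton, not_or] at hi'
      simp only [mem_range] at hi
      rw [hB0 i (by omega) (by omega), mul_zero]
  have hres : ∀ x : V, P 0 (A x) = ∑ j ∈ range (d + 1), P 0 (A (P j x)) := by
    intro x
    have h := LinearMap.congr_fun (sum_primIdem (T := As) hθs) x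
    rw [LinearMap.sum_apply, Module.End.one_apply] at h
    conv_lhs => rw [← h]
    rw [map_sum, map_sum]
  -- row sum
  have e1 : θ 0 = B 0 0 + B 0 1 + B 0 d := by
    have h := hres (v d)
    rw [hAd, map_smul, sum_congr rfl fun j hj => hrow j (by simp at hj; omega), ← sum_smul] at h
    rw [smul_left_injective F hp h]
    simpa using hsum fun _ => 1
  have hd1 : φ d • P 0 (v (d - 1)) = (θs 0 - θs d) • P 0 (v d) := by
    have h := primIdem_apply_succ hann hAs (Nat.zero_le d) (i := d - 1) (by omega)
    rw [show d - 1 + 1 = d by omega] at h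
    exact h.symm
  -- row sum weighted by the eigenvalues of `As`
  have e2 : θs d * θ 0 + φ d * ψ d + θ 1 * (θs 0 - θs d)
      = θs 0 * B 0 0 + θs 1 * B 0 1 + θs d * B 0 d := by
    have h := hres (As (v d))
    have hr : ∀ j ∈ range (d + 1), P 0 (A (P j (As (v d)))) = (θs j * B 0 j) • P 0 (v d) := by
      intro j hj
      have hj' : j ≤ d := by simp at hj; omega
      rw [primIdem_apply_map hann hj', map_smul, map_smul, hrow j hj', smul_smul]
    have hl : P 0 (A (As (v d)))
        = (θs d * θ 0 + φ d * ψ d + θ 1 * (θs 0 - θs d)) • P 0 (v d) := by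
      have h1 := hA (d - 1) (by omega)
      rw [show d - (d - 1) = 1 by omega, show d - 1 + 1 = d by omega] at h1
      rw [hAs d (by omega) le_rfl, map_add, map_smul, map_smul, hAd, h1]
      simp only [map_add, map_smul, smul_add]
      rw [smul_comm (φ d) (θ 1), hd1]
      module
    rw [hl, sum_congr rfl hr, ← sum_smul] at h
    rw [smul_left_injective F hp h]
    exact hsum θs
  -- the diagonal entry `B 0 0`
  have e3 : (θs 0 - θs 1) * B 0 0 = (θs 0 - θs 1) * θ d + ψ 1 * φ 1 := by
    obtain ⟨a, ha⟩ := Submodule.mem_span_singleton.1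
      (primIdem_zero_apply_mem_span hθs hann hAs0 hAs hspan (v d))
    have ha0 : a ≠ 0 := fun h => hp (by rw [hP, ← ha, h, zero_smul])
    have h := hrow 0 (Nat.zero_le d)
    rw [hP, ← ha, map_smul, map_smul, smul_comm (B 0 0) a] at h
    have h' := smul_right_injective V ha0 h
    have h0 : primIdem d As θs 0 (v 0) = v 0 := primIdem_apply_self hθs (Nat.zero_le d) hAs0
    have h1 := primIdem_apply_succ hann hAs (Nat.zero_le d) (i := 0) (by omega)
    rw [h0, zero_add] at h1
    rw [hA 0 (by omega), map_add, map_smul, map_smul, h0, Nat.sub_zero, zero_add] at h'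
    refine smul_left_injective F hne ?_
    simp only [mul_smul, add_smul]
    rw [← h', ← h1, smul_add, smul_comm (ψ 1)]
  refine ⟨by linear_combination θs 1 * e1 - e2 - e3, fun h => hcorner ?_⟩
  refine LinearMap.ext_on hspan ?_
  rintro _ ⟨i, hi, rfl⟩
  simp only [Set.mem_Iic] at hi
  simp only [Module.End.mul_apply, LinearMap.zero_apply]
  rcases hi.eq_or_lt with rfl | hi
  · exact (hrow i le_rfl).trans (by rw [h, zero_smul])
  · rw [hP, primIdem_last_apply_eq_zero hθs hann hAs0 hAs hi, map_zero, map_zero]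

/-- `ξ = (ϑ 1 - ϑ d)/(θ* 1 - θ* d)` and `ξ* = (ϑ d - ϑ 1)/(θ 1 - θ d)`;
in particular `ξ, ξ*` are nonzero. -/
theorem stmt18 {F V : Type*} [Field F] [AddCommGroup V] [Module F V]
    (d : ℕ) (hd : 3 ≤ d) (hdim : Module.finrank F V = d + 1)
    (Φ : CHSystem F V d) (φ : ℕ → F)
    (hφ0 : ∀ i, 1 ≤ i → i ≤ d → φ i ≠ 0)
    (hsplit : SplitSeq d Φ.A Φ.As Φ.θ Φ.θs φ)
    (hrec : ∃ β : F, BetaRecurrent β d Φ.θ ∧ BetaRecurrent β d Φ.θs ∧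
      BetaRecurrent β (d+1) (vth d Φ.θ Φ.θs φ))
    (ustar u : V) (hustar0 : ustar ≠ 0) (hu0 : u ≠ 0)
    (hustar : ustar ∈ LinearMap.range (primIdem d Φ.As Φ.θs 0))
    (hu : u ∈ LinearMap.range (primIdem d Φ.A Φ.θ 0))
    -- `Bs` is the matrix representing `A*` in the `Φ`-standard basis `{E i ustar}`
    (Bs : ℕ → ℕ → F)
    (hBs : ∀ j ≤ d, Φ.As (primIdem d Φ.A Φ.θ j ustar)
      = ∑ i ∈ Finset.range (d+1), Bs i j • primIdem d Φ.A Φ.θ i ustar)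
    -- `B` is the matrix representing `A` in the `Φ*`-standard basis `{E* i u}`
    (B : ℕ → ℕ → F)
    (hB : ∀ j ≤ d, Φ.A (primIdem d Φ.As Φ.θs j u)
      = ∑ i ∈ Finset.range (d+1), B i j • primIdem d Φ.As Φ.θs i u)
    (ξ ξs : F) (hξ : ξ = B 0 d) (hξs : ξs = Bs 0 d) :
    ξ = (vth d Φ.θ Φ.θs φ 1 - vth d Φ.θ Φ.θs φ d) / (Φ.θs 1 - Φ.θs d) ∧
    ξs = (vth d Φ.θ Φ.θs φ d - vth d Φ.θ Φ.θs φ 1) / (Φ.θ 1 - Φ.θ d) ∧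
    ξ ≠ 0 ∧ ξs ≠ 0 := by
  obtain ⟨v, hli, hspan, hA, hAd, hAs0, hAs⟩ := hsplit
  have hv0 : v 0 ≠ 0 := hli.ne_zero (⟨0, by omega⟩ : Fin (d + 1))
  have hvd : v d ≠ 0 := hli.ne_zero (⟨d, by omega⟩ : Fin (d + 1))
  have hspan' : Submodule.span F ((fun i => v (d - i)) '' Set.Iic d) = ⊤ := by
    rw [← hspan]
    congr 1
    ext x
    constructor
    · rintro ⟨i, -, rfl⟩
      exact ⟨d - i, by simp, rfl⟩
    · rintro ⟨i, hi, rfl⟩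
      exact ⟨d - i, by simp, congrArg v (Nat.sub_sub_self hi)⟩
  have hA0' : Φ.A (v (d - 0)) = Φ.θ 0 • v (d - 0) := by simpa using hAd
  have hA' : ∀ i, 1 ≤ i → i ≤ d →
      Φ.A (v (d - i)) = Φ.θ i • v (d - i) + (1 : F) • v (d - (i - 1)) := by
    intro i h1 h2
    rw [hA (d - i) (by omega), one_smul, show d - (d - i) = i by omega,
      show d - i + 1 = d - (i - 1) by omega]
  have hAs' : ∀ i < d, Φ.As (v (d - i))
      = Φ.θs (d - i) • v (d - i) + φ (d - (i + 1) + 1) • v (d - (i + 1)) := by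
    intro i hi
    rw [hAs (d - i) (by omega) (by omega), show d - (i + 1) + 1 = d - i by omega,
      show d - i - 1 = d - (i + 1) by omega]
  have hu' : u ∈ Submodule.span F {v d} := by
    obtain ⟨x, rfl⟩ := hu
    exact primIdem_zero_apply_mem_span (v := fun i => v (d - i)) (φ := fun _ => 1)
      Φ.θ_inj Φ.A_ann hA0' hA' hspan' x
  have hustar' : ustar ∈ Submodule.span F {v 0} := by
    obtain ⟨x, rfl⟩ := hustar
    exact primIdem_zero_apply_mem_span Φ.θs_inj Φ.As_ann hAs0 hAs hspan x
  obtain ⟨h1, h2⟩ := corner_entry_of_bidiagonal (ψ := fun _ => 1) (by omega) Φ.θs_inj Φ.As_ann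
    hv0 hspan (fun i hi => by rw [hA i hi, one_smul]) hAd hAs0 hAs hφ0
    (fun j hj hj' => Φ.circ₃ 0 (by omega) j (by omega) (by omega))
    (Φ.circ₄ 0 (by omega) d le_rfl (by omega)) hu' hu0 hB
  obtain ⟨h3, h4⟩ := corner_entry_of_bidiagonal (v := fun i => v (d - i)) (φ := fun _ => 1)
    (ψ := fun i => φ (d - i + 1)) (by omega) Φ.θ_inj Φ.A_ann
    hvd hspan' hAs' (by simpa using hAs0) hA0' hA' (fun _ _ _ => one_ne_zero)
    (fun j hj hj' => Φ.circ₁ 0 (by omega) j (by omega) (by omega))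
    (Φ.circ₂ 0 (by omega) d le_rfl (by omega)) (by simpa using hustar') hustar0 hBs
  have hne : Φ.θ 1 - Φ.θ d ≠ 0 := fun h => by
    have := Φ.θ_inj 1 (by omega) d le_rfl (sub_eq_zero.1 h)
    omega
  have hnes : Φ.θs 1 - Φ.θs d ≠ 0 := fun h => by
    have := Φ.θs_inj 1 (by omega) d le_rfl (sub_eq_zero.1 h)
    omega
  have hvth1 : vth d Φ.θ Φ.θs φ 1 = φ 1 - (Φ.θs 1 - Φ.θs 0) * (Φ.θ d - Φ.θ 0) := by
    rw [vth, if_pos (by omega), Nat.sub_add_cancel (by omega)]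
  have hvthd : vth d Φ.θ Φ.θs φ d = φ d - (Φ.θs d - Φ.θs 0) * (Φ.θ 1 - Φ.θ 0) := by
    rw [vth, if_pos (by omega), Nat.sub_self, zero_add]
  simp only [Nat.sub_self, zero_add, Nat.sub_add_cancel (show 1 ≤ d by omega)] at h3
  subst hξ hξs
  refine ⟨?_, ?_, h2, h4⟩
  · rw [eq_div_iff hnes, hvth1, hvthd]
    linear_combination -h1
  · rw [eq_div_iff hne, hvth1, hvthd]
    linear_combination -h3
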